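/- arXiv:1909.02546 — 2 statements merged into one kernel-verified Lean document; each statement's English description precedes it below -/
import Mathlib

section
/- Let W be a standard Brownian motion, let T > 0 and θ > 0, and set W̄ = T^{−1} ∫_0^T W(u) du. Then E[ exp( −(θ²/2) ∫_0^T (W(u) − W̄)² du ) ] = ( θT / sinh(θT) )^{1/2}. -/
open MeasureTheory ProbabilityTheory Filter

/-- `W` is a standard Brownian motion under `P`: it is measurable in `ω` for each time,
has continuous paths on `[0,∞)`, starts at `0`, and every finite linear combination
`∑ i, c i * W (t i)` with times `t i ≥ 0` is a centered Gaussian with variance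
`∑ i, ∑ j, c i * c j * min (t i) (t j)` (i.e. `W` is a centered Gaussian process with
covariance `Cov(W s, W t) = min s t`). -/
def IsStdBM {Ω : Type*} [MeasurableSpace Ω] (P : Measure Ω) (W : ℝ → Ω → ℝ) : Prop :=
  (∀ t : ℝ, Measurable (W t)) ∧
  (∀ ω, ContinuousOn (fun t => W t ω) (Set.Ici 0)) ∧
  (∀ ω, W 0 ω = 0) ∧
  ∀ (n : ℕ) (t : Fin n → ℝ) (c : Fin n → ℝ), (∀ i, 0 ≤ t i) →
    P.map (fun ω => ∑ i, c i * W (t i) ω) =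
      gaussianReal 0 (∑ i, ∑ j, c i * c j * min (t i) (t j)).toNNReal

open scoped Topology

/-- The largest point of the grid `{T * i / n}` lying to the left of `u`. -/
noncomputable def gridFloor (T : ℝ) (n : ℕ) (u : ℝ) : ℝ := T * (⌊n * u / T⌋₊ : ℝ) / n

lemma measurable_comp_gridFloor (T : ℝ) (n : ℕ) (h : ℝ → ℝ) :
    Measurable fun u => h (gridFloor T n u) := by
  have : Measurable fun u : ℝ => ⌊n * u / T⌋₊ := Nat.measurable_floor.comp (by fun_prop)
  exact (measurable_from_top (f := fun i : ℕ => h (T * i / n))).comp this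

lemma gridFloor_nonneg {T : ℝ} (hT : 0 < T) (n : ℕ) (u : ℝ) : 0 ≤ gridFloor T n u := by
  unfold gridFloor; positivity

lemma gridFloor_le {T : ℝ} (hT : 0 < T) (n : ℕ) {u : ℝ} (hu : 0 ≤ u) : gridFloor T n u ≤ u := by
  rcases Nat.eq_zero_or_pos n with rfl | hn
  · simpa [gridFloor] using hu
  have hn' : (0 : ℝ) < n := by exact_mod_cast hn
  have := Nat.floor_le (a := n * u / T) (by positivity)
  rw [le_div_iff₀ hT] at this
  rw [gridFloor, div_le_iff₀ hn']
  linarith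

lemma gridFloor_mem_Icc {T : ℝ} (hT : 0 < T) (n : ℕ) {u : ℝ} (hu : u ∈ Set.Icc 0 T) :
    gridFloor T n u ∈ Set.Icc 0 T :=
  ⟨gridFloor_nonneg hT n u, (gridFloor_le hT n hu.1).trans hu.2⟩

lemma tendsto_gridFloor {T : ℝ} (hT : 0 < T) {u : ℝ} (hu : 0 ≤ u) :
    Tendsto (fun n : ℕ => gridFloor T n u) atTop (𝓝 u) := by
  have h := ((tendsto_nat_floor_mul_div_atTop (R := ℝ) (a := u / T) (by positivity)).comp
    tendsto_natCast_atTop_atTop).const_mul T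
  rw [mul_div_cancel₀ _ hT.ne'] at h
  refine h.congr fun n => ?_
  simp only [Function.comp_apply, gridFloor]
  rw [mul_div_assoc, mul_comm (u / T), mul_div_assoc]

lemma integral_comp_gridFloor {T : ℝ} (hT : 0 < T) {n : ℕ} (hn : n ≠ 0) (h : ℝ → ℝ) :
    ∫ u in (0 : ℝ)..T, h (gridFloor T n u) = ∑ i : Fin n, T / n * h (T * (i : ℕ) / n) := by
  have hn' : (0 : ℝ) < n := by positivity
  have hle : ∀ k : ℕ, T * k / n ≤ T * (k + 1 : ℕ) / n := fun k => by
    push_cast; gcongr; linarith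
  have hEq : ∀ k : ℕ, Set.EqOn (fun u => h (gridFloor T n u)) (fun _ => h (T * k / n))
      (Set.Ioo (T * k / n) (T * (k + 1 : ℕ) / n)) := by
    intro k u hu
    have h1 := hu.1
    have h2 := hu.2
    rw [div_lt_iff₀ hn'] at h1
    rw [lt_div_iff₀ hn'] at h2
    push_cast at h2
    have : ⌊n * u / T⌋₊ = k := by
      have hu0 : 0 ≤ u := le_trans (by positivity) hu.1.le
      rw [Nat.floor_eq_iff (by positivity)]
      rw [le_div_iff₀ hT, div_lt_iff₀ hT]
      constructor <;> linarith
    simp only [gridFloor, this]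
  have hint : ∀ k < n, IntervalIntegrable (fun u => h (gridFloor T n u)) volume
      (T * k / n) (T * (k + 1 : ℕ) / n) := fun k _ => by
    rw [intervalIntegrable_iff_integrableOn_Ioo_of_le (hle k)]
    exact (integrableOn_const (by simp)).congr_fun (hEq k).symm measurableSet_Ioo
  have := intervalIntegral.sum_integral_adjacent_intervals (a := fun k : ℕ => T * k / n) hint
  simp only [Nat.cast_zero, mul_zero, zero_div, mul_div_cancel_right₀ T hn'.ne'] at this
  rw [← this, Finset.sum_range]
  refine Finset.sum_congr rfl fun i _ => ?_
  rw [intervalIntegral.integral_congr_Ioo_of_le (hle i) (hEq i), intervalIntegral.integral_const]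
  push_cast
  rw [smul_eq_mul]
  ring

lemma tendsto_integral_comp_gridFloor {T : ℝ} (hT : 0 < T) {h : ℝ → ℝ}
    (hh : ContinuousOn h (Set.Icc 0 T)) :
    Tendsto (fun n : ℕ => ∫ u in (0 : ℝ)..T, h (gridFloor T n u)) atTop
      (𝓝 (∫ u in (0 : ℝ)..T, h u)) := by
  obtain ⟨C, hC⟩ := isCompact_Icc.exists_bound_of_continuousOn hh
  refine intervalIntegral.tendsto_integral_filter_of_dominated_convergence (fun _ => C)
    (.of_forall fun n => (measurable_comp_gridFloor T n h).aestronglyMeasurable)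
    (.of_forall fun n => ae_of_all _ fun u hu => ?_) (by simp) (ae_of_all _ fun u hu => ?_)
  all_goals
    rw [Set.uIoc_of_le hT.le] at hu
    have hu' := Set.Ioc_subset_Icc_self hu
  · exact hC _ (gridFloor_mem_Icc hT n hu')
  · refine (hh u hu').tendsto.comp (tendsto_nhdsWithin_iff.2 ⟨tendsto_gridFloor hT hu'.1, ?_⟩)
    exact .of_forall fun n => gridFloor_mem_Icc hT n hu'

lemma tendsto_integral_integral_comp_gridFloor {T : ℝ} (hT : 0 < T) {H : ℝ → ℝ → ℝ}
    (hH : Continuous fun p : ℝ × ℝ => H p.1 p.2) :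
    Tendsto (fun n : ℕ => ∫ u in (0 : ℝ)..T, ∫ v in (0 : ℝ)..T,
      H (gridFloor T n u) (gridFloor T n v)) atTop
      (𝓝 (∫ u in (0 : ℝ)..T, ∫ v in (0 : ℝ)..T, H u v)) := by
  obtain ⟨C, hC⟩ := (isCompact_Icc.prod isCompact_Icc).exists_bound_of_continuousOn
    (s := Set.Icc (0 : ℝ) T ×ˢ Set.Icc (0 : ℝ) T) hH.continuousOn
  have hb : ∀ n : ℕ, ∀ u ∈ Set.Icc 0 T, ∀ v ∈ Set.Icc 0 T,
      ‖H (gridFloor T n u) (gridFloor T n v)‖ ≤ C := fun n u hu v hv =>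
    hC (_, _) ⟨gridFloor_mem_Icc hT n hu, gridFloor_mem_Icc hT n hv⟩
  refine intervalIntegral.tendsto_integral_filter_of_dominated_convergence (fun _ => C * |T - 0|)
    (.of_forall fun n => (measurable_comp_gridFloor T n
      fun x => ∫ v in (0 : ℝ)..T, H x (gridFloor T n v)).aestronglyMeasurable)
    (.of_forall fun n => ae_of_all _ fun u hu => ?_) (by simp) (ae_of_all _ fun u hu => ?_)
  all_goals
    rw [Set.uIoc_of_le hT.le] at hu
    have hu' := Set.Ioc_subset_Icc_self hu
  · refine intervalIntegral.norm_integral_le_of_norm_le_const fun v hv => ?_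
    rw [Set.uIoc_of_le hT.le] at hv
    exact hb n u hu' v (Set.Ioc_subset_Icc_self hv)
  · refine intervalIntegral.tendsto_integral_filter_of_dominated_convergence (fun _ => C)
      (.of_forall fun n => (measurable_comp_gridFloor T n _).aestronglyMeasurable)
      (.of_forall fun n => ae_of_all _ fun v hv => ?_) (by simp) (ae_of_all _ fun v hv => ?_)
    all_goals
      rw [Set.uIoc_of_le hT.le] at hv
      have hv' := Set.Ioc_subset_Icc_self hv
    · exact hb n u hu' v hv'
    · exact (hH.tendsto (u, v)).comp
        ((tendsto_gridFloor hT hu'.1).prodMk_nhds (tendsto_gridFloor hT hv'.1))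

lemma integral_exp_neg_mul_sq_gaussianReal {b : ℝ} (hb : 0 ≤ b) {v : NNReal} (hv : v ≠ 0) :
    ∫ x, Real.exp (-b * x ^ 2) ∂(gaussianReal 0 v) = (√(1 + 2 * b * v))⁻¹ := by
  have hv' : (0 : ℝ) < v := by positivity
  rw [integral_gaussianReal_eq_integral_smul hv]
  have : ∀ x : ℝ, gaussianPDFReal 0 v x • Real.exp (-b * x ^ 2)
      = (√(2 * Real.pi * v))⁻¹ * Real.exp (-(b + (2 * (v : ℝ))⁻¹) * x ^ 2) := fun x => by
    rw [gaussianPDFReal, smul_eq_mul, mul_assoc, ← Real.exp_add]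
    congr 2
    field_simp
    ring
  simp_rw [this]
  rw [integral_const_mul, integral_gaussian, ← Real.sqrt_inv, ← Real.sqrt_inv,
    ← Real.sqrt_mul (by positivity)]
  congr 1
  have := Real.pi_pos
  field_simp
  ring

/-- Random variables whose joint characteristic function is that of independent centered Gaussians
are independent centered Gaussians. -/
lemma iIndepFun_and_map_eq_of_integral_cexp {Ω : Type*} [MeasurableSpace Ω] {P : Measure Ω}
    [IsProbabilityMeasure P] {n : ℕ} {Y : Fin n → Ω → ℝ} (hY : ∀ k, Measurable (Y k))
    (s : Fin n → NNReal)
    (h : ∀ t : Fin n → ℝ, ∫ ω, Complex.exp ((∑ k, t k * Y k ω : ℝ) * Complex.I) ∂P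
      = Complex.exp ((-(∑ k, t k ^ 2 * s k) / 2 : ℝ))) :
    iIndepFun Y P ∧ ∀ k, P.map (Y k) = gaussianReal 0 (s k) := by
  have hmap : ∀ k, P.map (Y k) = gaussianReal 0 (s k) := fun k => by
    have := Measure.isProbabilityMeasure_map (μ := P) (hY k).aemeasurable
    refine Measure.ext_of_charFun (funext fun x => ?_)
    rw [charFun_gaussianReal, charFun_apply_real,
      integral_map (hY k).aemeasurable (by fun_prop)]
    have := h (Pi.single k x)
    simp only [Pi.single_apply, ite_mul, zero_mul, Finset.sum_ite_eq', Finset.mem_univ, if_true,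
      ite_pow, ne_eq, OfNat.ofNat_ne_zero, not_false_eq_true, zero_pow] at this
    push_cast at this
    rw [this]
    congr 1
    simp
    ring
  refine ⟨(iIndepFun_iff_charFun_pi fun k => (hY k).aemeasurable).2 fun t => ?_, hmap⟩
  rw [charFun_apply, integral_map (by fun_prop) (by fun_prop)]
  simp_rw [hmap, charFun_gaussianReal]
  rw [← Complex.exp_sum]
  convert h t using 1
  · simp [PiLp.inner_apply]
  · congr 1
    push_cast
    simp [Finset.sum_neg_distrib, Finset.sum_div, neg_div, mul_comm]

lemma integral_exp_neg_mul_sum_sq {Ω : Type*} [MeasurableSpace Ω] {P : Measure Ω}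
    [IsProbabilityMeasure P] {n : ℕ} {Y : Fin n → Ω → ℝ} (hY : ∀ k, Measurable (Y k))
    {s : Fin n → ℝ} (hs : ∀ k, 0 < s k)
    (h : ∀ t : Fin n → ℝ, ∫ ω, Complex.exp ((∑ k, t k * Y k ω : ℝ) * Complex.I) ∂P
      = Complex.exp ((-(∑ k, t k ^ 2 * s k) / 2 : ℝ))) {b : ℝ} (hb : 0 ≤ b) :
    ∫ ω, Real.exp (-b * ∑ k, Y k ω ^ 2) ∂P = (√(∏ k, (1 + 2 * b * s k)))⁻¹ := by
  obtain ⟨hind, hmap⟩ := iIndepFun_and_map_eq_of_integral_cexp hY (fun k => (s k).toNNReal)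
    (by simpa only [fun k => Real.coe_toNNReal _ (hs k).le] using h)
  simp_rw [Finset.mul_sum, Real.exp_sum]
  rw [hind.integral_fun_prod_comp (f := fun _ y => Real.exp (-b * y ^ 2))
    (fun k => (hY k).aemeasurable) (fun k => by fun_prop), Real.sqrt_prod, ← Finset.prod_inv_distrib]
  · refine Finset.prod_congr rfl fun k _ => ?_
    rw [← integral_map (φ := Y k) (f := fun y => Real.exp (-b * y ^ 2)) (hY k).aemeasurable
      (by fun_prop), hmap, integral_exp_neg_mul_sq_gaussianReal hb]
    · rw [Real.coe_toNNReal _ (hs k).le]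
    · exact (Real.toNNReal_pos.2 (hs k)).ne'
  · intro k _
    have := (hs k).le
    positivity

lemma tendsto_prod_one_add_sq_div {x : ℝ} (hx : x ≠ 0) :
    Tendsto (fun n : ℕ => ∏ k : Fin n, (1 + x ^ 2 / (((k : ℕ) + 1) * Real.pi) ^ 2)) atTop
      (𝓝 (Real.sinh x / x)) := by
  have hpi := Real.pi_ne_zero
  have hpi' : (Real.pi : ℂ) ≠ 0 := by exact_mod_cast hpi
  have hx' : (x : ℂ) ≠ 0 := by exact_mod_cast hx
  have h := Complex.tendsto_euler_sin_prod (x / Real.pi * Complex.I)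
  have h2 := (h.div_const (x * Complex.I))
  rw [show (Real.pi : ℂ) * (x / Real.pi * Complex.I) = x * Complex.I by field_simp,
    Complex.sin_mul_I, mul_div_mul_right _ _ Complex.I_ne_zero] at h2
  have h3 := (Complex.continuous_re.tendsto _).comp h2
  rw [← Complex.ofReal_sinh, ← Complex.ofReal_div (Real.sinh x), Complex.ofReal_re] at h3
  refine h3.congr fun n => ?_
  rw [Function.comp_apply, mul_div_cancel_left₀ _ (mul_ne_zero hx' Complex.I_ne_zero),
    ← Finset.prod_range (fun k : ℕ => 1 + x ^ 2 / ((k + 1) * Real.pi) ^ 2),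
    ← Complex.ofReal_re (∏ k ∈ _, _)]
  congr 1
  push_cast
  refine Finset.prod_congr rfl fun k _ => ?_
  rw [mul_pow, Complex.I_sq, mul_pow]
  have : (k : ℂ) + 1 ≠ 0 := by exact_mod_cast k.succ_ne_zero
  field_simp
  ring

lemma integral_cos_mul_min {a T u : ℝ} (ha : a ≠ 0) (hu : u ∈ Set.Icc 0 T)
    (hT : Real.sin (a * T) = 0) :
    ∫ v in (0 : ℝ)..T, Real.cos (a * v) * min u v = (Real.cos (a * u) - 1) / a ^ 2 := by
  have hi : ∀ x y : ℝ, IntervalIntegrable (fun v => Real.cos (a * v) * min u v) volume x y :=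
    fun x y => (by fun_prop : Continuous fun v => Real.cos (a * v) * min u v).intervalIntegrable _ _
  rw [← intervalIntegral.integral_add_adjacent_intervals (hi 0 u) (hi u T)]
  have h1 : ∫ v in (0 : ℝ)..u, Real.cos (a * v) * min u v
      = (u * Real.sin (a * u) / a + Real.cos (a * u) / a ^ 2) - 1 / a ^ 2 := by
    have hd : ∀ v ∈ Set.uIcc 0 u, HasDerivAt
        (fun v => v * Real.sin (a * v) / a + Real.cos (a * v) / a ^ 2)
        (Real.cos (a * v) * v) v := fun v _ => by
      have hl : HasDerivAt (fun v : ℝ => a * v) a v := by simpa using (hasDerivAt_id v).const_mul a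
      convert! (((hasDerivAt_id v).mul hl.sin).div_const a).add (hl.cos.div_const (a ^ 2)) using 1
      simp only [id]
      field_simp
      ring
    rw [intervalIntegral.integral_congr (g := fun v => Real.cos (a * v) * v),
      intervalIntegral.integral_eq_sub_of_hasDerivAt hd
        ((by fun_prop : Continuous fun v => Real.cos (a * v) * v).intervalIntegrable _ _)]
    · simp
    · intro v hv
      rw [Set.uIcc_of_le hu.1] at hv
      simp only [min_eq_right hv.2]
  have h2 : ∫ v in u..T, Real.cos (a * v) * min u v = -(u * Real.sin (a * u) / a) := by
    rw [intervalIntegral.integral_congr (g := fun v => Real.cos (a * v) * u),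
      intervalIntegral.integral_mul_const, intervalIntegral.integral_comp_mul_left _ ha,
      integral_cos, hT, smul_eq_mul]
    · ring
    · intro v hv
      rw [Set.uIcc_of_le hu.2] at hv
      simp only [min_eq_left hv.1]
  rw [h1, h2]
  ring

/-- The frequency of the `k`-th nonconstant element of the cosine basis of `[0, T]`. -/
noncomputable def cosFreq (T : ℝ) (k : ℕ) : ℝ := (k + 1) * Real.pi / T

lemma cosFreq_pos {T : ℝ} (hT : 0 < T) (k : ℕ) : 0 < cosFreq T k := by
  unfold cosFreq; positivity

lemma cosFreq_mul {T : ℝ} (hT : T ≠ 0) (k : ℕ) : cosFreq T k * T = ((k + 1 : ℕ) : ℝ) * Real.pi := by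
  unfold cosFreq; push_cast; field_simp

lemma sin_cosFreq_mul {T : ℝ} (hT : T ≠ 0) (k : ℕ) : Real.sin (cosFreq T k * T) = 0 := by
  rw [cosFreq_mul hT, Real.sin_nat_mul_pi]

lemma integral_cos_cosFreq {T : ℝ} (hT : 0 < T) (k : ℕ) :
    ∫ u in (0 : ℝ)..T, Real.cos (cosFreq T k * u) = 0 := by
  rw [intervalIntegral.integral_comp_mul_left _ (cosFreq_pos hT k).ne', integral_cos,
    sin_cosFreq_mul hT.ne']
  simp

lemma integral_cos_mul_cos_cosFreq {T : ℝ} (hT : 0 < T) (j k : ℕ) :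
    ∫ u in (0 : ℝ)..T, Real.cos (cosFreq T j * u) * Real.cos (cosFreq T k * u)
      = if j = k then T / 2 else 0 := by
  have hprod : ∀ u, Real.cos (cosFreq T j * u) * Real.cos (cosFreq T k * u)
      = (Real.cos ((cosFreq T j - cosFreq T k) * u)
        + Real.cos ((cosFreq T j + cosFreq T k) * u)) / 2 := fun u => by
    rw [sub_mul, add_mul, Real.cos_sub, Real.cos_add]; ring
  simp_rw [hprod]
  rw [intervalIntegral.integral_div, intervalIntegral.integral_add
    ((by fun_prop : Continuous _).intervalIntegrable _ _)
    ((by fun_prop : Continuous _).intervalIntegrable _ _)]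
  have hsum : ∫ u in (0 : ℝ)..T, Real.cos ((cosFreq T j + cosFreq T k) * u) = 0 := by
    rw [intervalIntegral.integral_comp_mul_left _
      (add_pos (cosFreq_pos hT j) (cosFreq_pos hT k)).ne', integral_cos, add_mul, Real.sin_add,
      sin_cosFreq_mul hT.ne', sin_cosFreq_mul hT.ne']
    simp
  rw [hsum, add_zero]
  split_ifs with h
  · simp [h]
  · have hne : cosFreq T j - cosFreq T k ≠ 0 := by
      unfold cosFreq
      rw [← sub_div, ← sub_mul, add_sub_add_right_eq_sub]
      have : (j : ℝ) - k ≠ 0 := sub_ne_zero.2 (by exact_mod_cast h)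
      have := Real.pi_ne_zero
      positivity
    rw [intervalIntegral.integral_comp_mul_left _ hne, integral_cos, sub_mul, Real.sin_sub,
      sin_cosFreq_mul hT.ne', sin_cosFreq_mul hT.ne']
    simp

/-- The cosines diagonalize the Brownian covariance. -/
lemma integral_integral_cosSum_mul_min {T : ℝ} (hT : 0 < T) {n : ℕ} (t : Fin n → ℝ) :
    ∫ u in (0 : ℝ)..T, ∫ v in (0 : ℝ)..T, (∑ k, t k * Real.cos (cosFreq T k * u)) *
        (∑ k, t k * Real.cos (cosFreq T k * v)) * min u v
      = ∑ k, t k ^ 2 * (T / (2 * cosFreq T k ^ 2)) := by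
  have hinner : ∀ u ∈ Set.uIcc 0 T, ∫ v in (0 : ℝ)..T,
      (∑ k, t k * Real.cos (cosFreq T k * u)) * (∑ k, t k * Real.cos (cosFreq T k * v)) * min u v
      = ∑ j, ∑ k, t j * t k / cosFreq T k ^ 2 * (Real.cos (cosFreq T j * u) *
        Real.cos (cosFreq T k * u) - Real.cos (cosFreq T j * u)) := by
    intro u hu
    rw [Set.uIcc_of_le hT.le] at hu
    simp_rw [mul_assoc]
    rw [intervalIntegral.integral_const_mul]
    simp_rw [Finset.sum_mul, mul_assoc]
    rw [intervalIntegral.integral_finsetSum fun k _ =>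
      (by fun_prop : Continuous _).intervalIntegrable _ _]
    refine Finset.sum_congr rfl fun j _ => ?_
    rw [Finset.mul_sum, Finset.mul_sum]
    refine Finset.sum_congr rfl fun k _ => ?_
    rw [intervalIntegral.integral_const_mul,
      integral_cos_mul_min (cosFreq_pos hT k).ne' hu (sin_cosFreq_mul hT.ne' k)]
    ring
  rw [intervalIntegral.integral_congr hinner, intervalIntegral.integral_finsetSum fun k _ =>
      (by fun_prop : Continuous _).intervalIntegrable _ _]
  refine Finset.sum_congr rfl fun j _ => ?_
  rw [intervalIntegral.integral_finsetSum fun k _ =>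
      (by fun_prop : Continuous _).intervalIntegrable _ _]
  have hterm : ∀ k : Fin n, ∫ u in (0 : ℝ)..T, t j * t k / cosFreq T k ^ 2 *
      (Real.cos (cosFreq T j * u) * Real.cos (cosFreq T k * u) - Real.cos (cosFreq T j * u))
      = if j = k then t j ^ 2 * (T / (2 * cosFreq T j ^ 2)) else 0 := fun k => by
    rw [intervalIntegral.integral_const_mul, intervalIntegral.integral_sub
      ((by fun_prop : Continuous _).intervalIntegrable _ _)
      ((by fun_prop : Continuous _).intervalIntegrable _ _), integral_cos_mul_cos_cosFreq hT,
      integral_cos_cosFreq hT]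
    simp only [Fin.val_inj]
    split_ifs with h
    · subst h
      ring
    · simp
  simp_rw [hterm]
  simp

lemma intervalIntegral_symm_eq {E : Type*} [NormedAddCommGroup E] [NormedSpace ℝ E] {f : ℝ → E}
    (hf : Continuous f) (T : ℝ) :
    ∫ x in (-T)..T, f x = ∫ x in (0 : ℝ)..T, (f x + f (-x)) := by
  have hneg : ∫ x in (0 : ℝ)..T, f (-x) = ∫ x in (-T)..0, f x := by
    simp [intervalIntegral.integral_comp_neg]
  have hf' : Continuous fun x => f (-x) := hf.comp continuous_neg
  rw [intervalIntegral.integral_add (hf.intervalIntegrable _ _) (hf'.intervalIntegrable _ _), hneg,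
    add_comm, intervalIntegral.integral_add_adjacent_intervals (hf.intervalIntegrable _ _)
      (hf.intervalIntegrable _ _)]

lemma fourierCoeffOn_comp_abs {T : ℝ} (hT : 0 < T) (hab : -T < T) {g : ℝ → ℝ}
    (hg : Continuous fun x : ℝ => g |x|) (n : ℤ) :
    fourierCoeffOn hab (fun x => (g |x| : ℂ)) n
      = ((T⁻¹ * ∫ u in (0 : ℝ)..T, Real.cos (n * Real.pi / T * u) * g u : ℝ) : ℂ) := by
  have hT' : (T : ℂ) ≠ 0 := by exact_mod_cast hT.ne'
  rw [fourierCoeffOn_eq_integral]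
  simp_rw [fourier_coe_apply]
  have hg' : Continuous fun x : ℝ => (g |x| : ℂ) := Complex.continuous_ofReal.comp hg
  have hc : Continuous fun x : ℝ => Complex.exp (2 * Real.pi * Complex.I * ((-n : ℤ) : ℂ) * x /
      ((T - -T : ℝ) : ℂ)) • (g |x| : ℂ) := by fun_prop
  rw [intervalIntegral_symm_eq hc, intervalIntegral.integral_congr
    (g := fun u => ((2 * (Real.cos (n * Real.pi / T * u) * g u) : ℝ) : ℂ)),
    intervalIntegral.integral_ofReal, intervalIntegral.integral_const_mul, Complex.real_smul]
  · rw [← Complex.ofReal_mul]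
    congr 1
    field_simp
    ring
  · intro u hu
    rw [Set.uIcc_of_le hT.le] at hu
    simp only [abs_neg, abs_of_nonneg hu.1, smul_eq_mul]
    push_cast
    rw [Complex.cos, ← add_mul, show ∀ a b c : ℂ, 2 * ((a + b) / 2 * c) = (b + a) * c by
      intros; ring]
    congr 3 <;> field_simp <;> ring

/-- Parseval's identity for the cosine basis of `[0, T]`. -/
lemma hasSum_sq_integral_cos {T : ℝ} (hT : 0 < T) {g : ℝ → ℝ} (hg : ContinuousOn g (Set.Ici 0)) :
    HasSum (fun k : ℕ => 2 / T * (∫ u in (0 : ℝ)..T, Real.cos (cosFreq T k * u) * g u) ^ 2)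
      (∫ u in (0 : ℝ)..T, (g u - T⁻¹ * ∫ v in (0 : ℝ)..T, g v) ^ 2) := by
  have hab : -T < T := by linarith
  have hcont : Continuous fun x : ℝ => g |x| :=
    hg.comp_continuous continuous_abs fun x => abs_nonneg x
  have hgI : ContinuousOn g (Set.uIcc 0 T) := hg.mono (by
    rw [Set.uIcc_of_le hT.le]; exact Set.Icc_subset_Ici_self)
  have hc : Continuous fun x : ℝ => (g |x| : ℂ) := Complex.continuous_ofReal.comp hcont
  have hL2 : MemLp (fun x => (g |x| : ℂ)) 2 (volume.restrict (Set.Ioc (-T) T)) := by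
    obtain ⟨C, hC⟩ := (isCompact_Icc (a := -T) (b := T)).exists_bound_of_continuousOn hc.continuousOn
    refine MemLp.of_bound hc.aestronglyMeasurable C ?_
    filter_upwards [ae_restrict_mem measurableSet_Ioc] with x hx
    exact hC x (Set.Ioc_subset_Icc_self hx)
  have hsq : (T - -T)⁻¹ • ∫ x in (-T)..T, ‖(g |x| : ℂ)‖ ^ 2
      = T⁻¹ * ∫ u in (0 : ℝ)..T, g u ^ 2 := by
    have hn : Continuous fun x : ℝ => ‖(g |x| : ℂ)‖ ^ 2 := hc.norm.pow 2
    rw [intervalIntegral_symm_eq hn,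
      intervalIntegral.integral_congr (g := fun u => 2 * g u ^ 2),
      intervalIntegral.integral_const_mul, smul_eq_mul]
    · field_simp
      ring
    · intro u hu
      rw [Set.uIcc_of_le hT.le] at hu
      simp only [abs_neg, abs_of_nonneg hu.1, Complex.norm_real, Real.norm_eq_abs, sq_abs]
      ring
  have h := (hasSum_sq_fourierCoeffOn hab hL2)
  simp_rw [hsq, fourierCoeffOn_comp_abs hT hab hcont, Complex.norm_real, Real.norm_eq_abs,
    sq_abs] at h
  have h2 := (((hasSum_nat_add_iff' 1).2 h.nat_add_neg).mul_left T)
  refine (congrArg₂ (fun f a => HasSum f a) (funext fun k => ?_) ?_).mpr h2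
  · have hneg : ∀ u : ℝ, Real.cos (-((k : ℝ) + 1) * Real.pi / T * u)
        = Real.cos (((k : ℝ) + 1) * Real.pi / T * u) := fun u => by
      rw [← Real.cos_neg]; congr 1; ring
    push_cast
    simp_rw [hneg, cosFreq]
    field_simp
    ring
  · set m := T⁻¹ * ∫ v in (0 : ℝ)..T, g v with hm
    have hint : ∫ v in (0 : ℝ)..T, g v = T * m := by rw [hm]; field_simp
    have hsub : ∀ u, (g u - m) ^ 2 = g u ^ 2 - 2 * m * g u + m ^ 2 := fun u => by ring
    simp_rw [hsub]
    rw [intervalIntegral.integral_add, intervalIntegral.integral_sub,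
      intervalIntegral.integral_const_mul, intervalIntegral.integral_const, hint]
    · simp [hint]
      field_simp
      ring
    · exact (hgI.pow 2).intervalIntegrable
    · exact (continuousOn_const.mul hgI).intervalIntegrable
    · exact ((hgI.pow 2).sub (continuousOn_const.mul hgI)).intervalIntegrable
    · simp

namespace IsStdBM

variable {Ω : Type*} [MeasurableSpace Ω] {P : Measure Ω} {W : ℝ → Ω → ℝ} {T : ℝ} {f : ℝ → ℝ}

lemma continuousOn_mul_Icc (hW : IsStdBM P W) (hf : Continuous f) (ω : Ω) :
    ContinuousOn (fun u => f u * W u ω) (Set.Icc 0 T) :=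
  hf.continuousOn.mul ((hW.2.1 ω).mono Set.Icc_subset_Ici_self)

lemma intervalIntegrable_mul (hW : IsStdBM P W) (hT : 0 < T) (hf : Continuous f) (ω : Ω) :
    IntervalIntegrable (fun u => f u * W u ω) volume 0 T :=
  (Set.uIcc_of_le hT.le ▸ hW.continuousOn_mul_Icc hf ω).intervalIntegrable

/-- Riemann sums approximating `∫ u in 0..T, f u * W u ω`. -/
lemma tendsto_riemannSum (hW : IsStdBM P W) (hT : 0 < T) (hf : Continuous f) (ω : Ω) :
    Tendsto (fun n : ℕ => ∑ i : Fin n, T / n * f (T * (i : ℕ) / n) * W (T * (i : ℕ) / n) ω) atTop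
      (𝓝 (∫ u in (0 : ℝ)..T, f u * W u ω)) := by
  refine (tendsto_integral_comp_gridFloor hT (hW.continuousOn_mul_Icc hf ω)).congr' ?_
  filter_upwards [eventually_ne_atTop 0] with n hn
  rw [integral_comp_gridFloor hT hn fun u => f u * W u ω]
  simp_rw [mul_assoc]

lemma measurable_integral_mul (hW : IsStdBM P W) (hT : 0 < T) (hf : Continuous f) :
    Measurable fun ω => ∫ u in (0 : ℝ)..T, f u * W u ω :=
  measurable_of_tendsto_metrizable
    (fun _ => Finset.measurable_fun_sum _ fun _ _ => (hW.1 _).const_mul _)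
    (tendsto_pi_nhds.2 fun ω => hW.tendsto_riemannSum hT hf ω)

lemma integral_cexp_integral_mul [IsProbabilityMeasure P] (hW : IsStdBM P W) (hT : 0 < T)
    (hf : Continuous f) :
    ∫ ω, Complex.exp ((∫ u in (0 : ℝ)..T, f u * W u ω : ℝ) * Complex.I) ∂P
      = Complex.exp ((-max (∫ u in (0 : ℝ)..T, ∫ v in (0 : ℝ)..T, f u * f v * min u v) 0 / 2 : ℝ))
      := by
  have hmeas : ∀ n : ℕ, Measurable fun ω =>
      ∑ i : Fin n, T / n * f (T * (i : ℕ) / n) * W (T * (i : ℕ) / n) ω := fun n =>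
    Finset.measurable_fun_sum _ fun _ _ => (hW.1 _).const_mul _
  have hlim : Tendsto (fun n : ℕ => ∫ ω, Complex.exp ((∑ i : Fin n,
      T / n * f (T * (i : ℕ) / n) * W (T * (i : ℕ) / n) ω : ℝ) * Complex.I) ∂P) atTop
      (𝓝 (∫ ω, Complex.exp ((∫ u in (0 : ℝ)..T, f u * W u ω : ℝ) * Complex.I) ∂P)) := by
    refine tendsto_integral_of_dominated_convergence (fun _ => 1) (fun n => ?_)
      (integrable_const _) (fun n => ae_of_all _ fun ω => ?_) (ae_of_all _ fun ω => ?_)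
    · have := hmeas n
      exact Measurable.aestronglyMeasurable (by fun_prop)
    · rw [Complex.norm_exp_ofReal_mul_I]
    · have : Continuous fun x : ℝ => Complex.exp (x * Complex.I) := by fun_prop
      exact (this.tendsto _).comp (hW.tendsto_riemannSum hT hf ω)
  have hvar := tendsto_integral_integral_comp_gridFloor hT
    (H := fun u v => f u * f v * min u v) (by fun_prop)
  refine tendsto_nhds_unique hlim ?_
  have hcont : Continuous fun x : ℝ => Complex.exp ((-max x 0 / 2 : ℝ)) := by fun_prop
  refine ((hcont.tendsto _).comp hvar).congr' ?_
  filter_upwards [eventually_ne_atTop 0] with n hn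
  have hlaw := hW.2.2.2 n (fun i => T * (i : ℕ) / n) (fun i => T / n * f (T * (i : ℕ) / n))
    (fun i => by positivity)
  have hchar := charFun_gaussianReal (μ := 0) (v := (∑ i : Fin n, ∑ j : Fin n,
    T / n * f (T * (i : ℕ) / n) * (T / n * f (T * (j : ℕ) / n)) *
      min (T * (i : ℕ) / n) (T * (j : ℕ) / n)).toNNReal) 1
  rw [← hlaw, charFun_apply_real, integral_map (hmeas n).aemeasurable (by fun_prop)] at hchar
  simp only [Complex.ofReal_one, one_mul] at hchar
  rw [hchar, Function.comp_apply,
    integral_comp_gridFloor hT hn fun x => ∫ v in (0 : ℝ)..T,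
      f x * f (gridFloor T n v) * min x (gridFloor T n v)]
  simp_rw [fun x => integral_comp_gridFloor hT hn fun y => f x * f y * min x y]
  rw [Real.coe_toNNReal']
  congr 1
  push_cast
  simp only [one_pow, mul_one, zero_mul, zero_sub, neg_div]
  congr 4
  simp_rw [Finset.mul_sum]
  refine Finset.sum_congr rfl fun i _ => Finset.sum_congr rfl fun j _ => ?_
  ring

lemma integral_cexp_sum_integral_cos [IsProbabilityMeasure P] (hW : IsStdBM P W) (hT : 0 < T)
    {n : ℕ} (t : Fin n → ℝ) :
    ∫ ω, Complex.exp ((∑ k, t k * ∫ u in (0 : ℝ)..T, Real.cos (cosFreq T k * u) * W u ω : ℝ)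
        * Complex.I) ∂P
      = Complex.exp ((-(∑ k, t k ^ 2 * (T / (2 * cosFreq T k ^ 2))) / 2 : ℝ)) := by
  have h := hW.integral_cexp_integral_mul hT
    (f := fun u => ∑ k, t k * Real.cos (cosFreq T k * u)) (by fun_prop)
  rw [integral_integral_cosSum_mul_min hT, max_eq_left
    (Finset.sum_nonneg fun k _ => by positivity)] at h
  rw [← h]
  congr 1
  ext ω
  congr 3
  simp_rw [Finset.sum_mul, mul_assoc]
  rw [intervalIntegral.integral_finsetSum fun k _ =>
    (hW.intervalIntegrable_mul hT (by fun_prop) ω).const_mul _]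
  simp_rw [intervalIntegral.integral_const_mul]

end IsStdBM

theorem stmt_1 {Ω : Type*} [MeasurableSpace Ω] (P : Measure Ω) [IsProbabilityMeasure P]
    (W : ℝ → Ω → ℝ) (hW : IsStdBM P W) (T θ : ℝ) (hT : 0 < T) (hθ : 0 < θ) :
    ∫ ω, Real.exp (-(θ ^ 2 / 2) *
        ∫ u in (0:ℝ)..T, (W u ω - T⁻¹ * ∫ v in (0:ℝ)..T, W v ω) ^ 2) ∂P
      = Real.sqrt (θ * T / Real.sinh (θ * T)) := by
  have hmeas : ∀ k : ℕ, Measurable fun ω => ∫ u in (0 : ℝ)..T, Real.cos (cosFreq T k * u) * W u ω :=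
    fun k => hW.measurable_integral_mul hT (by fun_prop)
  have hparseval : ∀ ω, Tendsto (fun n : ℕ => -(θ ^ 2 / T) * ∑ k : Fin n,
      (∫ u in (0 : ℝ)..T, Real.cos (cosFreq T k * u) * W u ω) ^ 2) atTop
      (𝓝 (-(θ ^ 2 / 2) * ∫ u in (0:ℝ)..T, (W u ω - T⁻¹ * ∫ v in (0:ℝ)..T, W v ω) ^ 2)) := fun ω => by
    refine ((hasSum_sq_integral_cos hT (hW.2.1 ω)).tendsto_sum_nat.const_mul
      (-(θ ^ 2 / 2))).congr fun n => ?_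
    rw [Finset.sum_range, ← Finset.mul_sum]
    field_simp
  have hlim : Tendsto (fun n : ℕ => ∫ ω, Real.exp (-(θ ^ 2 / T) * ∑ k : Fin n,
      (∫ u in (0 : ℝ)..T, Real.cos (cosFreq T k * u) * W u ω) ^ 2) ∂P) atTop
      (𝓝 (∫ ω, Real.exp (-(θ ^ 2 / 2) *
        ∫ u in (0:ℝ)..T, (W u ω - T⁻¹ * ∫ v in (0:ℝ)..T, W v ω) ^ 2) ∂P)) := by
    refine tendsto_integral_of_dominated_convergence (fun _ => 1) (fun n => ?_)
      (integrable_const _) (fun n => ae_of_all _ fun ω => ?_) (ae_of_all _ fun ω => ?_)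
    · exact Measurable.aestronglyMeasurable (Real.measurable_exp.comp (Measurable.const_mul
        (Finset.measurable_fun_sum (Finset.univ : Finset (Fin n)) fun k _ =>
          (hmeas (k : ℕ)).pow_const 2) _))
    · rw [Real.norm_eq_abs, Real.abs_exp, Real.exp_le_one_iff, neg_mul, neg_nonpos]
      positivity
    · exact (Real.continuous_exp.tendsto _).comp (hparseval ω)
  refine tendsto_nhds_unique hlim ?_
  have hpos : 0 < θ * T := by positivity
  have hprod := tendsto_prod_one_add_sq_div hpos.ne'
  have hroot := (hprod.sqrt).inv₀ (Real.sqrt_pos.2 (div_pos (Real.sinh_pos_iff.2 hpos) hpos)).ne'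
  rw [← Real.sqrt_inv, inv_div] at hroot
  refine hroot.congr fun n => ?_
  rw [integral_exp_neg_mul_sum_sq (fun k : Fin n => hmeas k) (fun k => ?_)
    (hW.integral_cexp_sum_integral_cos hT) (by positivity)]
  · congr 3
    ext k
    have := Real.pi_pos
    rw [cosFreq]
    field_simp
  · have := cosFreq_pos hT k
    positivity
end

section
/- Let W be a standard Brownian motion, let T > 0, θ > 0 and z ∈ ℝ. Then E[ exp( −∫_0^T ( (θ²/2) W(u)² + z W(u) ) du ) ] = (cosh(θT))^{−1/2} · exp( (z²/(2θ³)) ( θT − tanh(θT) ) ). -/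
open MeasureTheory ProbabilityTheory Filter

open scoped NNReal Topology

/-- A Brownian motion restricted to nonnegative times is a pre-Brownian process. -/
lemma IsStdBM.isPreBrownianReal {Ω : Type*} [MeasurableSpace Ω] {P : Measure Ω}
    [IsProbabilityMeasure P] {W : ℝ → Ω → ℝ} (hW : IsStdBM P W) :
    IsPreBrownianReal (fun (t : ℝ≥0) => W t) P := by
  obtain ⟨hmeas, -, -, hlaw⟩ := hW
  have hgauss : IsGaussianProcess (fun (t : ℝ≥0) => W t) P := by
    refine ⟨fun I => ⟨isGaussian_of_map_eq_gaussianReal fun L => ?_⟩⟩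
    let e := I.equivFin
    have hL (ω : Ω) : L (I.restrict (fun t : ℝ≥0 => W t ω)) =
        ∑ i, L (Pi.single (e.symm i) 1) * W ((e.symm i : ℝ≥0) : ℝ) ω := by
      rw [e.symm.sum_comp (fun t : I => L (Pi.single t 1) * W ((t : ℝ≥0) : ℝ) ω)]
      refine (LinearMap.pi_apply_eq_sum_univ (L : (I → ℝ) →ₗ[ℝ] ℝ) _).trans
        (Finset.sum_congr rfl fun t _ => ?_)
      have hsingle : (fun s => if t = s then (1 : ℝ) else 0) = Pi.single t 1 := by
        ext s
        simp [Pi.single_apply, eq_comm]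
      rw [hsingle, smul_eq_mul, mul_comm]
      rfl
    have hlaw_L := hlaw _ (fun i => ((e.symm i : ℝ≥0) : ℝ)) (fun i => L (Pi.single (e.symm i) 1))
      (fun i => NNReal.coe_nonneg _)
    simp_rw [← hL] at hlaw_L
    exact ⟨0, _, (Measure.map_map (by fun_prop) (by fun_prop)).trans hlaw_L⟩
  have hcomb (s t : ℝ≥0) (a b : ℝ) : P.map (fun ω => a * W s ω + b * W t ω) =
      gaussianReal 0 (a * a * s + 2 * (a * b * min s t) + b * b * t : ℝ).toNNReal := by
    have := hlaw 2 ![(s : ℝ), t] ![a, b] (by simp [Fin.forall_fin_two])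
    simp only [Fin.sum_univ_two, Matrix.cons_val_zero, Matrix.cons_val_one, min_self] at this
    rw [this, min_comm (t : ℝ) s, NNReal.coe_min]
    congr 2
    ring
  have hvar (s t : ℝ≥0) (a b : ℝ) : Var[fun ω => a * W s ω + b * W t ω; P] =
      (a * a * s + 2 * (a * b * min s t) + b * b * t : ℝ).toNNReal := by
    have h : HasLaw (fun ω => a * W s ω + b * W t ω) _ P :=
      ⟨by fun_prop, hcomb s t a b⟩
    rw [h.variance_eq, variance_id_gaussianReal]
  have hmem (s : ℝ≥0) : MemLp (W s) 2 P := (hgauss.hasGaussianLaw_eval s).memLp_two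
  refine hgauss.isPreBrownianReal_of_covariance (fun t => ?_) (fun s t hst => ?_)
  · have h : HasLaw (fun ω => 1 * W t ω + 0 * W t ω) _ P := ⟨by fun_prop, hcomb t t 1 0⟩
    have := h.integral_eq
    simpa [integral_id_gaussianReal] using this
  · have h1 := hvar s t 1 1
    have h2 := hvar s t 1 0
    have h3 := hvar s t 0 1
    have h4 := variance_fun_add (hmem s) (hmem t)
    simp only [one_mul, zero_mul, add_zero, zero_add, mul_zero, mul_one, NNReal.coe_min,
      min_eq_left (NNReal.coe_le_coe.2 hst)] at h1 h2 h3
    rw [Real.coe_toNNReal _ (by positivity)] at h1 h2 h3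
    change cov[W s, W t; P] = s
    rw [h1] at h4
    linarith [h4, h2, h3]

/-- The Laplace-type transform of a shifted square under a centred Gaussian law. -/
lemma integral_exp_neg_sq_gaussianReal {r : ℝ} (hr : 0 ≤ r) {h : ℝ≥0} (hh : h ≠ 0) (v : ℝ) :
    ∫ y, Real.exp (-(r / 2 * (v + y) ^ 2)) ∂(gaussianReal 0 h) =
      (√(1 + r * h))⁻¹ * Real.exp (-(r / (1 + r * h) / 2 * v ^ 2)) := by
  have hpos : (0 : ℝ) < h := by positivity
  have hd : 0 < 1 + r * h := by positivity
  rw [integral_gaussianReal_eq_integral_smul hh]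
  have hdens (y : ℝ) : gaussianPDFReal 0 h y • Real.exp (-(r / 2 * (v + y) ^ 2)) =
      ((√(2 * Real.pi * h))⁻¹ * Real.exp (-(r / (1 + r * h) / 2 * v ^ 2))) *
        Real.exp (-((1 + r * h) / (2 * h)) * (y + r * h * v / (1 + r * h)) ^ 2) := by
    rw [gaussianPDFReal, smul_eq_mul, mul_assoc (√_)⁻¹, mul_assoc (√_)⁻¹, ← Real.exp_add,
      ← Real.exp_add]
    congr 2
    field_simp
    ring
  simp_rw [hdens]
  rw [integral_const_mul,
    integral_add_right_eq_self (fun y : ℝ => Real.exp (-((1 + r * h) / (2 * h)) * y ^ 2)),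
    integral_gaussian]
  have : Real.pi / ((1 + r * h) / (2 * h)) = (2 * Real.pi * h) * (1 + r * h)⁻¹ := by
    field_simp
  rw [this, Real.sqrt_mul (show 0 ≤ 2 * Real.pi * (h : ℝ) by positivity), Real.sqrt_inv]
  have : √(2 * Real.pi * h) ≠ 0 := by positivity
  field_simp

/-- The Riccati-type coefficient obtained by integrating out `i` grid steps of size `h`. -/
noncomputable def discreteRiccati (θ h : ℝ) (i : ℕ) : ℝ :=
  (Real.cosh (θ * ((i + 1) * h)) / Real.cosh (θ * (i * h)) - 1) / h

lemma discreteRiccati_zero (θ h : ℝ) :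
    discreteRiccati θ h 0 = (Real.cosh (θ * h) - 1) / h := by
  simp [discreteRiccati]

lemma one_add_discreteRiccati_mul (θ : ℝ) {h : ℝ} (hh : h ≠ 0) (i : ℕ) :
    1 + discreteRiccati θ h i * h =
      Real.cosh (θ * ((i + 1) * h)) / Real.cosh (θ * (i * h)) := by
  rw [discreteRiccati, div_mul_cancel₀ _ hh]
  ring

lemma discreteRiccati_nonneg (θ : ℝ) {h : ℝ} (hh : 0 < h) (i : ℕ) :
    0 ≤ discreteRiccati θ h i := by
  unfold discreteRiccati
  refine div_nonneg (sub_nonneg.2 ((one_le_div (Real.cosh_pos _)).2 ?_)) hh.le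
  rw [Real.cosh_le_cosh, abs_mul θ, abs_mul θ]
  rw [abs_of_nonneg (show (0 : ℝ) ≤ i * h by positivity),
    abs_of_nonneg (show (0 : ℝ) ≤ (i + 1) * h by positivity)]
  gcongr
  linarith

lemma discreteRiccati_succ (θ : ℝ) {h : ℝ} (hh : h ≠ 0) (i : ℕ) :
    discreteRiccati θ h (i + 1) = 2 * ((Real.cosh (θ * h) - 1) / h) +
      discreteRiccati θ h i / (1 + discreteRiccati θ h i * h) := by
  rw [one_add_discreteRiccati_mul θ hh, discreteRiccati, discreteRiccati]
  have h0 := (Real.cosh_pos (θ * (i * h))).ne'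
  have h1 := (Real.cosh_pos (θ * ((i + 1) * h))).ne'
  have key : Real.cosh (θ * ((i + 1 + 1) * h)) + Real.cosh (θ * (i * h)) =
      2 * Real.cosh (θ * h) * Real.cosh (θ * ((i + 1) * h)) := by
    rw [show θ * ((i + 1 + 1) * h) = θ * ((i + 1) * h) + θ * h by ring,
      show θ * (i * h) = θ * ((i + 1) * h) - θ * h by ring, Real.cosh_add, Real.cosh_sub]
    ring
  push_cast
  generalize Real.cosh (θ * ((i + 1 + 1) * h)) = y₂ at *
  generalize Real.cosh (θ * ((i + 1) * h)) = y₁ at *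
  generalize Real.cosh (θ * (i * h)) = y₀ at *
  generalize Real.cosh (θ * h) = y at *
  field_simp
  linear_combination key

lemma discreteRiccati_eq (θ h : ℝ) (i : ℕ) :
    discreteRiccati θ h i = (Real.cosh (θ * h) - 1) / h +
      Real.tanh (θ * (i * h)) * (Real.sinh (θ * h) / h) := by
  have h0 := (Real.cosh_pos (θ * (i * h))).ne'
  rw [discreteRiccati, show θ * ((i + 1) * h) = θ * (i * h) + θ * h by ring, Real.cosh_add,
    Real.tanh_eq_sinh_div_cosh]
  field_simp
  ring

/-- The Gaussian transform of a trapezoidal sum of squares along a pre-Brownian process, in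
closed form. -/
lemma integral_exp_neg_sum_sq {Ω : Type*} [MeasurableSpace Ω] {P : Measure Ω}
    {B : ℝ≥0 → Ω → ℝ} (hB : IsPreBrownianReal B P) (hm : ∀ t, Measurable (B t)) (θ x : ℝ) {h : ℝ≥0}
    (hh : h ≠ 0) (k i : ℕ) :
    ∫ ω, Real.exp (-((Real.cosh (θ * h) - 1) / h * ∑ j ∈ Finset.range k, (x + B (j * h) ω) ^ 2 +
        discreteRiccati θ h i / 2 * (x + B (k * h) ω) ^ 2)) ∂P =
      √(Real.cosh (θ * (i * h)) / Real.cosh (θ * ((i + k : ℕ) * h))) *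
        Real.exp (-(discreteRiccati θ h (i + k) / 2 * x ^ 2)) := by
  have hP : IsProbabilityMeasure P := hB.isGaussianProcess.isProbabilityMeasure
  have hpos : (0 : ℝ) < h := by positivity
  set p : ℝ := (Real.cosh (θ * h) - 1) / h with hp
  have hp0 : 0 ≤ p := div_nonneg (sub_nonneg.2 (Real.one_le_cosh _)) hpos.le
  induction k generalizing i with
  | zero =>
    have h0 : ∀ᵐ ω ∂P, Real.exp (-(p * ∑ j ∈ Finset.range 0, (x + B (j * h) ω) ^ 2 +
        discreteRiccati θ h i / 2 * (x + B ((0 : ℕ) * h) ω) ^ 2)) =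
        Real.exp (-(discreteRiccati θ h i / 2 * x ^ 2)) := by
      filter_upwards [hB.eval_zero_ae_eq_zero] with ω hω
      simp [hω]
    rw [integral_congr_ae h0]
    simp [div_self (Real.cosh_pos _).ne']
  | succ k ih =>
    set r := discreteRiccati θ h i with hr
    have hr0 : 0 ≤ r := discreteRiccati_nonneg θ hpos i
    let Y : Ω → ℝ × ℝ := fun ω =>
      (p * ∑ j ∈ Finset.range (k + 1), (x + B (j * h) ω) ^ 2, x + B (k * h) ω)
    let ξ : Ω → ℝ := fun ω => B (k * h + h) ω - B (k * h) ω
    have hYm : Measurable Y := by fun_prop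
    have hξm : Measurable ξ := by fun_prop
    have hind : IndepFun Y ξ P := by
      have hle (j : ℕ) (hj : j ∈ Finset.range (k + 1)) : (j : ℝ≥0) * h ≤ k * h := by
        gcongr
        exact Finset.mem_range_succ_iff.1 hj
      let g : (Set.Iic ((k : ℝ≥0) * h) → ℝ) → ℝ × ℝ := fun f =>
        (p * ∑ j ∈ (Finset.range (k + 1)).attach, (x + f ⟨j * h, hle j j.2⟩) ^ 2,
          x + f ⟨k * h, Set.mem_Iic.2 le_rfl⟩)
      have hg : Measurable g := by fun_prop
      have := ((hB.indepFun_shift (k * h)).symm).comp hg (measurable_pi_apply h)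
      refine this.congr (ae_of_all _ fun ω => ?_) (ae_of_all _ fun ω => rfl)
      ext
      · simp only [Y, g, Function.comp]
        rw [Finset.sum_attach (Finset.range (k + 1)) (fun j : ℕ => (x + B (j * h) ω) ^ 2)]
      · rfl
    have hξ : P.map ξ = gaussianReal 0 h := by
      have := (hB.hasLaw_sub (k * h + h) (k * h)).map_eq
      have hdist : nndist ((k * h + h : ℝ≥0) : ℝ) ((k * h : ℝ≥0) : ℝ) = h := by
        apply NNReal.coe_injective
        rw [coe_nndist, Real.dist_eq]
        simp
      exact this.trans (congrArg _ hdist)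
    let G : (ℝ × ℝ) × ℝ → ℝ := fun q => Real.exp (-(q.1.1 + r / 2 * (q.1.2 + q.2) ^ 2))
    have hGm : Measurable G := by fun_prop
    have hcalc : ∫ ω, G (Y ω, ξ ω) ∂P =
        ∫ ω, (√(1 + r * h))⁻¹ * Real.exp (-(p * ∑ j ∈ Finset.range k, (x + B (j * h) ω) ^ 2 +
          discreteRiccati θ h (i + 1) / 2 * (x + B (k * h) ω) ^ 2)) ∂P := by
      have hpush : ∫ ω, G (Y ω, ξ ω) ∂P = ∫ q, G q ∂((P.map Y).prod (gaussianReal 0 h)) := by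
        rw [← hξ, ← hind.map_prod_eq_prod_map_map hYm.aemeasurable hξm.aemeasurable,
          integral_map (by fun_prop) (by fun_prop)]
      have hprob : IsProbabilityMeasure (P.map Y) :=
        Measure.isProbabilityMeasure_map hYm.aemeasurable
      have hY0 : ∀ᵐ q ∂((P.map Y).prod (gaussianReal 0 h)), ‖G q‖ ≤ 1 := by
        have : ∀ᵐ y ∂(P.map Y), 0 ≤ y.1 := by
          rw [ae_map_iff hYm.aemeasurable (measurableSet_le (by fun_prop) (by fun_prop))]
          refine ae_of_all _ fun ω => ?_
          positivity
        filter_upwards [Measure.quasiMeasurePreserving_fst.ae this] with q hq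
        rw [Real.norm_of_nonneg (Real.exp_pos _).le, Real.exp_le_one_iff]
        have : 0 ≤ r / 2 * (q.1.2 + q.2) ^ 2 := by positivity
        linarith
      have hGint : Integrable G ((P.map Y).prod (gaussianReal 0 h)) :=
        Integrable.of_bound (by fun_prop) 1 hY0
      rw [hpush, integral_prod _ hGint, integral_map hYm.aemeasurable
        hGint.integral_prod_left.aestronglyMeasurable]
      refine integral_congr_ae (ae_of_all _ fun ω => ?_)
      simp only [G, neg_add, Real.exp_add]
      rw [integral_const_mul, integral_exp_neg_sq_gaussianReal hr0 hh, mul_left_comm,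
        ← Real.exp_add, ← Real.exp_add]
      congr 2
      simp only [Y]
      rw [Finset.sum_range_succ, discreteRiccati_succ θ hpos.ne', ← hp, ← hr]
      ring
    have hstep : ∀ ω, Real.exp (-(p * ∑ j ∈ Finset.range (k + 1), (x + B (j * h) ω) ^ 2 +
        r / 2 * (x + B ((k + 1 : ℕ) * h) ω) ^ 2)) = G (Y ω, ξ ω) := by
      intro ω
      have : ((k + 1 : ℕ) : ℝ≥0) * h = k * h + h := by push_cast; ring
      simp only [G, Y, ξ, this, add_add_sub_cancel]
    simp_rw [hstep]
    rw [hcalc, integral_const_mul, ih (i + 1), one_add_discreteRiccati_mul θ hpos.ne', ← mul_assoc,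
      show i + 1 + k = i + (k + 1) by ring, ← Real.sqrt_inv, ← Real.sqrt_mul (by positivity)]
    have h1 := (Real.cosh_pos (θ * ((i + 1) * h))).ne'
    congr 2
    push_cast
    field_simp

/-- Left Riemann sums over equal subintervals of a continuous function converge to its integral. -/
lemma tendsto_leftRiemannSum {f : ℝ → ℝ} {T : ℝ} (hT : 0 < T) (hf : ContinuousOn f (Set.Icc 0 T)) :
    Tendsto (fun n : ℕ => T / n * ∑ j ∈ Finset.range n, f (j * (T / n))) atTop
      (𝓝 (∫ u in (0 : ℝ)..T, f u)) := by
  rw [Metric.tendsto_atTop]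
  intro ε hε
  have huc := isCompact_Icc.uniformContinuousOn_of_continuous hf
  rw [Metric.uniformContinuousOn_iff] at huc
  obtain ⟨δ, hδ, hfδ⟩ := huc (ε / (2 * T)) (by positivity)
  obtain ⟨N, hN⟩ := exists_nat_gt (T / δ)
  refine ⟨N + 1, fun n hn => ?_⟩
  have hn0 : (0 : ℝ) < n := by exact_mod_cast (by omega : 0 < n)
  set h : ℝ := T / n with hh
  have hh0 : 0 < h := by positivity
  have hhδ : h < δ := by
    have : (N : ℝ) ≤ n := by exact_mod_cast (by omega : N ≤ n)
    rw [div_lt_iff₀ hδ] at hN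
    rw [hh, div_lt_iff₀ hn0]
    nlinarith
  have hnh : n * h = T := by rw [hh]; field_simp
  have hsub (j : ℕ) (hj : j < n) :
      Set.Icc ((j : ℝ) * h) (((j + 1 : ℕ) : ℝ) * h) ⊆ Set.Icc 0 T := by
    have : ((j + 1 : ℕ) : ℝ) ≤ n := by exact_mod_cast hj
    exact Set.Icc_subset_Icc (by positivity) (by rw [← hnh]; gcongr)
  have hle (j : ℕ) : (j : ℝ) * h ≤ ((j + 1 : ℕ) : ℝ) * h := by
    gcongr
    omega
  have hfi (j : ℕ) (hj : j < n) :
      IntervalIntegrable f volume ((j : ℝ) * h) (((j + 1 : ℕ) : ℝ) * h) :=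
    (hf.mono (hsub j hj)).intervalIntegrable_of_Icc (hle j)
  have hsum := intervalIntegral.sum_integral_adjacent_intervals
    (a := fun j : ℕ => (j : ℝ) * h) hfi
  simp only [Nat.cast_zero, zero_mul, hnh] at hsum
  rw [dist_comm, Real.dist_eq, ← hsum, Finset.mul_sum, ← Finset.sum_sub_distrib]
  have hterm (j : ℕ) (hj : j ∈ Finset.range n) :
      |(∫ u in ((j : ℝ) * h)..(((j + 1 : ℕ) : ℝ) * h), f u) - h * f (j * h)| ≤
        ε / (2 * T) * h := by
    have hj := Finset.mem_range.1 hj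
    have hlen : ((j + 1 : ℕ) : ℝ) * h - j * h = h := by push_cast; ring
    have hconst : h * f (j * h) =
        ∫ _ in ((j : ℝ) * h)..(((j + 1 : ℕ) : ℝ) * h), f (j * h) := by
      rw [intervalIntegral.integral_const, hlen, smul_eq_mul]
    rw [hconst, ← intervalIntegral.integral_sub (hfi j hj) (by simp), ← Real.norm_eq_abs]
    refine (intervalIntegral.norm_integral_le_of_norm_le_const (C := ε / (2 * T))
      fun u hu => ?_).trans_eq (by rw [hlen, abs_of_pos hh0])
    rw [Set.uIoc_of_le (hle j)] at hu
    have hu' : u - j * h ≤ h := by linarith [hu.2]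
    refine (hfδ u (hsub j hj ⟨hu.1.le, hu.2⟩) (j * h) (hsub j hj ⟨le_rfl, hle j⟩) ?_).le
    rw [Real.dist_eq, abs_of_pos (by linarith [hu.1])]
    linarith
  calc _ ≤ ∑ j ∈ Finset.range n, ε / (2 * T) * h :=
        (Finset.abs_sum_le_sum_abs _ _).trans (Finset.sum_le_sum hterm)
    _ = ε / 2 := by
        rw [Finset.sum_const, Finset.card_range, nsmul_eq_mul, mul_left_comm, hnh]
        field_simp
    _ < ε := half_lt_self hε

lemma tendsto_sinh_mul_div (c : ℝ) :
    Tendsto (fun h : ℝ => Real.sinh (c * h) / h) (𝓝[≠] 0) (𝓝 c) := by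
  have hd : HasDerivAt (fun h : ℝ => Real.sinh (c * h)) c 0 := by
    simpa using ((hasDerivAt_id (0 : ℝ)).const_mul c).sinh
  simpa [div_eq_inv_mul] using hd.tendsto_slope_zero

lemma tendsto_cosh_mul_sub_one_div_sq (c : ℝ) :
    Tendsto (fun h : ℝ => (Real.cosh (c * h) - 1) / h ^ 2) (𝓝[≠] 0) (𝓝 (c ^ 2 / 2)) := by
  have := ((tendsto_sinh_mul_div (c / 2)).pow 2).const_mul 2
  convert this using 2 with h
  · rw [show c * h = 2 * (c / 2 * h) by ring, Real.cosh_two_mul, Real.cosh_sq]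
    ring
  · ring

/-- The Cameron–Martin formula for a Brownian motion started from `x`. -/
lemma IsStdBM.integral_exp_neg_integral_sq {Ω : Type*} [MeasurableSpace Ω] {P : Measure Ω}
    [IsProbabilityMeasure P] {W : ℝ → Ω → ℝ} (hW : IsStdBM P W) {T : ℝ} (hT : 0 < T) (θ x : ℝ) :
    ∫ ω, Real.exp (-(θ ^ 2 / 2 * ∫ u in (0 : ℝ)..T, (x + W u ω) ^ 2)) ∂P =
      (√(Real.cosh (θ * T)))⁻¹ * Real.exp (-(Real.tanh (θ * T) * θ / 2 * x ^ 2)) := by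
  have hmeas := hW.1
  have hcont := hW.2.1
  let c : ℝ → ℝ := fun h => (Real.cosh (θ * h) - 1) / h
  let F : ℕ → Ω → ℝ := fun n ω =>
    Real.exp (-(c (T / n) * ∑ j ∈ Finset.range n, (x + W (j * (T / n)) ω) ^ 2 +
      discreteRiccati θ (T / n) 0 / 2 * (x + W (n * (T / n)) ω) ^ 2))
  have hh : Tendsto (fun n : ℕ => T / (n : ℝ)) atTop (𝓝[≠] 0) := by
    refine tendsto_nhdsWithin_iff.2 ⟨tendsto_const_div_atTop_nhds_zero_nat T, ?_⟩
    filter_upwards [eventually_gt_atTop 0] with n hn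
    have : (0 : ℝ) < n := by exact_mod_cast hn
    exact (div_pos hT this).ne'
  have hc2 : Tendsto (fun n : ℕ => c (T / n) / (T / n)) atTop (𝓝 (θ ^ 2 / 2)) := by
    refine ((tendsto_cosh_mul_sub_one_div_sq θ).comp hh).congr fun n => ?_
    simp only [c, Function.comp, div_div, sq]
  have hc0 : Tendsto (fun n : ℕ => c (T / n)) atTop (𝓝 0) := by
    have := hc2.mul (tendsto_nhdsWithin_iff.1 hh).1
    rw [mul_zero] at this
    refine this.congr' ?_
    filter_upwards [(tendsto_nhdsWithin_iff.1 hh).2] with n hn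
    exact div_mul_cancel₀ _ hn
  have hcpos (n : ℕ) : 0 ≤ c (T / n) :=
    div_nonneg (sub_nonneg.2 (Real.one_le_cosh _)) (by positivity)
  have hnT {n : ℕ} (hn : 0 < n) : (n : ℝ) * (T / n) = T := by
    have : (n : ℝ) ≠ 0 := by exact_mod_cast hn.ne'
    field_simp
  have hlim : Tendsto (fun n => ∫ ω, F n ω ∂P) atTop
      (𝓝 (∫ ω, Real.exp (-(θ ^ 2 / 2 * ∫ u in (0 : ℝ)..T, (x + W u ω) ^ 2)) ∂P)) := by
    refine tendsto_integral_of_dominated_convergence (fun _ => 1) (fun n => ?_)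
      (integrable_const _) (fun n => ae_of_all _ fun ω => ?_) (ae_of_all _ fun ω => ?_)
    · fun_prop
    · rw [Real.norm_of_nonneg (Real.exp_pos _).le, Real.exp_le_one_iff, neg_nonpos,
        discreteRiccati_zero]
      have := hcpos n
      positivity
    · refine (Real.continuous_exp.tendsto _).comp (Tendsto.neg ?_)
      have hR := tendsto_leftRiemannSum (f := fun u => (x + W u ω) ^ 2) hT
        (((hcont ω).mono Set.Icc_subset_Ici_self).const_add x |>.pow 2)
      have hend : Tendsto (fun n : ℕ => c (T / n) / 2 * (x + W T ω) ^ 2) atTop (𝓝 0) := by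
        simpa using (hc0.div_const 2).mul_const ((x + W T ω) ^ 2)
      have := (hc2.mul hR).add hend
      rw [add_zero] at this
      refine this.congr' ?_
      filter_upwards [eventually_gt_atTop 0, (tendsto_nhdsWithin_iff.1 hh).2] with n hn hn'
      rw [hnT hn, discreteRiccati_zero, ← mul_assoc, div_mul_cancel₀ _ hn']
  have hval : Tendsto (fun n => ∫ ω, F n ω ∂P) atTop
      (𝓝 ((√(Real.cosh (θ * T)))⁻¹ * Real.exp (-(Real.tanh (θ * T) * θ / 2 * x ^ 2)))) := by
    have hr : Tendsto (fun n : ℕ => discreteRiccati θ (T / n) n) atTop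
        (𝓝 (Real.tanh (θ * T) * θ)) := by
      have := hc0.add (((tendsto_sinh_mul_div θ).comp hh).const_mul (Real.tanh (θ * T)))
      rw [zero_add] at this
      refine this.congr' ?_
      filter_upwards [eventually_gt_atTop 0] with n hn
      rw [discreteRiccati_eq, hnT hn]
      rfl
    have hlim' := ((Real.continuous_exp.tendsto _).comp
      ((hr.div_const 2).mul_const (x ^ 2)).neg).const_mul (√(Real.cosh (θ * T)))⁻¹
    refine hlim'.congr' ?_
    filter_upwards [eventually_gt_atTop 0] with n hn
    have hn0 : (0 : ℝ) < n := by exact_mod_cast hn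
    let h : ℝ≥0 := ⟨T / n, by positivity⟩
    have hne : h ≠ 0 := fun h0 => (div_pos hT hn0).ne' (congrArg NNReal.toReal h0)
    have := integral_exp_neg_sum_sq hW.isPreBrownianReal (fun t => hmeas t) θ x hne n 0
    simp only [NNReal.coe_mul, NNReal.coe_natCast, zero_add, Nat.cast_zero, zero_mul, mul_zero,
      Real.cosh_zero] at this
    have hcoe : (h : ℝ) = T / n := rfl
    rw [hcoe, hnT hn, one_div, Real.sqrt_inv] at this
    simp only [F, c, Function.comp, hnT hn]
    exact this.symm
  exact tendsto_nhds_unique hlim hval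

theorem stmt_2 {Ω : Type*} [MeasurableSpace Ω] (P : Measure Ω) [IsProbabilityMeasure P]
    (W : ℝ → Ω → ℝ) (hW : IsStdBM P W) (T θ z : ℝ) (hT : 0 < T) (hθ : 0 < θ) :
    ∫ ω, Real.exp (-∫ u in (0:ℝ)..T, ((θ ^ 2 / 2) * (W u ω) ^ 2 + z * W u ω)) ∂P
      = (Real.sqrt (Real.cosh (θ * T)))⁻¹ *
        Real.exp ((z ^ 2 / (2 * θ ^ 3)) * (θ * T - Real.tanh (θ * T))) := by
  have hsquare (ω : Ω) :
      Real.exp (-∫ u in (0:ℝ)..T, ((θ ^ 2 / 2) * (W u ω) ^ 2 + z * W u ω)) =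
        Real.exp (T * (z ^ 2 / (2 * θ ^ 2))) *
          Real.exp (-(θ ^ 2 / 2 * ∫ u in (0:ℝ)..T, (z / θ ^ 2 + W u ω) ^ 2)) := by
    have hfi : IntervalIntegrable (fun u => θ ^ 2 / 2 * (z / θ ^ 2 + W u ω) ^ 2) volume 0 T :=
      ((((hW.2.1 ω).mono Set.Icc_subset_Ici_self).const_add _).pow 2
        |>.const_mul _).intervalIntegrable_of_Icc hT.le
    have hexp (u : ℝ) : θ ^ 2 / 2 * (W u ω) ^ 2 + z * W u ω =
        θ ^ 2 / 2 * (z / θ ^ 2 + W u ω) ^ 2 - z ^ 2 / (2 * θ ^ 2) := by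
      field_simp
      ring
    simp_rw [hexp]
    rw [intervalIntegral.integral_sub hfi (by simp), intervalIntegral.integral_const_mul,
      intervalIntegral.integral_const, ← Real.exp_add, smul_eq_mul]
    congr 1
    ring
  simp_rw [hsquare]
  rw [integral_const_mul, hW.integral_exp_neg_integral_sq hT, mul_left_comm, ← Real.exp_add]
  congr 2
  field_simp
  ring
end
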